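/- Let Γ be a round tree graph with horizontal branching in [2,H] and vertical branching V ≥ 2, and set Q = 1 + log V / log H. Then for every p with 1 ≤ p < Q, setting ε = (Q − p)/(p(Q − p + pQ)) > 0, there exists c > 0 such that for every real r > 1 there is a finite subgraph Y of Γ with c⁻¹·r ≤ |Y| ≤ c·r and |Y|·h^p(Y) ≥ c⁻¹·|Y|^{1 − 1/p + ε}. -/

import Mathlib

open Finset

/-- Vertices of a round tree graph: pairs of a word over `[H] = {0,…,H-1}` and a word
over `[V] = {0,…,V-1}`. -/
abbrev RTVert (H V : ℕ) := List (Fin H) × List (Fin V)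

/-- Strict lexicographic order on words (over `Fin n`). -/
def LexLt {n : ℕ} (w w' : List (Fin n)) : Prop := List.Lex (· < ·) w w'

/-- `Γ` is a round tree graph with vertical branching `V` and horizontal branching in
`[2,H]`, with vertex set `S ⊆ [H]^* × [V]^*`:
(0) `(∅,∅) ∈ S`;
(1) `|h| = |v|` for every `(h,v) ∈ S`;
(2) if `(hα, vβ) ∈ S` then `(h,v) ∈ S` and they are joined by a (vertical) edge;
(3) for `(h,v) ∈ S` and `β ∈ [V]` there is `Δ ∈ [2,H]` with
    `{α : (hα,vβ) ∈ S} = [Δ]`;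
(4) if `(h,v),(h',v) ∈ S` with `h,h'` consecutive in the lexicographic order on
    `{w : (w,v) ∈ S}`, they are joined by a (horizontal) edge;
(5) every edge of `Γ` is vertical or horizontal as above. -/
def IsRoundTreeGraph (H V : ℕ) (S : Set (RTVert H V)) (Γ : SimpleGraph (RTVert H V)) :
    Prop :=
  (([], []) ∈ S) ∧
  (∀ x ∈ S, x.1.length = x.2.length) ∧
  (∀ (h : List (Fin H)) (v : List (Fin V)) (α : Fin H) (β : Fin V),
      (h ++ [α], v ++ [β]) ∈ S → (h, v) ∈ S ∧ Γ.Adj (h, v) (h ++ [α], v ++ [β])) ∧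
  (∀ (h : List (Fin H)) (v : List (Fin V)), (h, v) ∈ S → ∀ β : Fin V,
      ∃ Δ : ℕ, 2 ≤ Δ ∧ Δ ≤ H ∧
        ∀ α : Fin H, ((h ++ [α], v ++ [β]) ∈ S ↔ (α : ℕ) < Δ)) ∧
  (∀ (h h' : List (Fin H)) (v : List (Fin V)),
      (h, v) ∈ S → (h', v) ∈ S → LexLt h h' →
      (¬∃ w, (w, v) ∈ S ∧ LexLt h w ∧ LexLt w h') →
      Γ.Adj (h, v) (h', v)) ∧
  (∀ x y : RTVert H V, Γ.Adj x y → x ∈ S ∧ y ∈ S ∧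
      ((∃ (α : Fin H) (β : Fin V), y = (x.1 ++ [α], x.2 ++ [β])) ∨
       (∃ (α : Fin H) (β : Fin V), x = (y.1 ++ [α], y.2 ++ [β])) ∨
       (x.2 = y.2 ∧
        ((LexLt x.1 y.1 ∧ ¬∃ w, (w, x.2) ∈ S ∧ LexLt x.1 w ∧ LexLt w y.1) ∨
         (LexLt y.1 x.1 ∧ ¬∃ w, (w, x.2) ∈ S ∧ LexLt y.1 w ∧ LexLt w x.1)))))

/-- The `ℓ^p` norm of a function on a finite vertex set. -/
noncomputable def lpNorm {W : Type*} [Fintype W] (p : ℝ) (f : W → ℝ) : ℝ :=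
  (∑ v, |f v| ^ p) ^ (1 / p)

/-- The `ℓ^p` norm of the gradient of `f` on a finite simple graph. -/
noncomputable def gradLpNorm {W : Type*} [Fintype W] (G : SimpleGraph W) (p : ℝ)
    (f : W → ℝ) : ℝ :=
  letI := Classical.decEq W
  letI := Classical.decRel G.Adj
  (∑ e ∈ G.edgeFinset,
    Sym2.lift ⟨fun x y => |f x - f y| ^ p,
      fun x y => by show |f x - f y| ^ p = |f y - f x| ^ p; rw [abs_sub_comm]⟩ e) ^ (1 / p)

/-- The `L^p`-Poincaré constant
`h^p(Y) = inf { ‖∇f‖_p / ‖f‖_p : f : V(Y) → ℝ, ∑ v, f v = 0, f ≢ 0 }`. -/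
noncomputable def poincareConst {W : Type*} [Fintype W] (G : SimpleGraph W) (p : ℝ) : ℝ :=
  sInf { c : ℝ | ∃ f : W → ℝ, (∑ v, f v) = 0 ∧ f ≠ 0 ∧ c = gradLpNorm G p f / lpNorm p f }



/-- words of length `j` over `Fin V` -/
def rtWords (V : ℕ) : ℕ → Finset (List (Fin V))
  | 0 => {[]}
  | j + 1 => (rtWords V j ×ˢ (Finset.univ : Finset (Fin V))).image (fun q => q.1 ++ [q.2])

theorem rtWords_sum (V j : ℕ) (φ : List (Fin V) → ℝ) :
    ∑ u ∈ rtWords V (j+1), φ u = ∑ u ∈ rtWords V j, ∑ β, φ (u ++ [β]) := by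
  rw [rtWords, Finset.sum_image, Finset.sum_product]
  rintro ⟨a, b⟩ _ ⟨c, d⟩ _ h
  simpa using h

theorem mem_rtWords (V j : ℕ) (u : List (Fin V)) : u ∈ rtWords V j ↔ u.length = j := by
  induction j generalizing u with
  | zero => simp [rtWords]
  | succ j ih =>
    simp only [rtWords, Finset.mem_image, Finset.mem_product, ih, Finset.mem_univ, and_true,
      Prod.exists]
    constructor
    · rintro ⟨a, b, h, rfl⟩; simp [h]
    · intro h
      have hne : u ≠ [] := by rintro rfl; simp at h
      refine ⟨u.dropLast, u.getLast hne, by simp [h], List.dropLast_append_getLast hne⟩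

theorem card_rtWords (V j : ℕ) : (rtWords V j).card = V ^ j := by
  induction j with
  | zero => simp [rtWords]
  | succ j ih =>
    rw [rtWords, Finset.card_image_of_injective, Finset.card_product, ih]
    · simp [pow_succ]
    · rintro ⟨a, b⟩ ⟨c, d⟩ h
      simpa using h

/-- vertical energy -/
noncomputable def rtTreeE (V m : ℕ) (p : ℝ) (F : List (Fin V) → ℝ) : ℝ :=
  ∑ j ∈ range m, ∑ u ∈ rtWords V j, ∑ β, |F (u ++ [β]) - F u| ^ p

theorem rtTree_step (V m : ℕ) (hV : 2 ≤ V) (p : ℝ) (hp : 1 ≤ p) (F : List (Fin V) → ℝ) (j : ℕ)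
    (hj : j ≤ m) :
    (∑ u ∈ rtWords V j, |F u - F []| ^ p) ^ (1/p) ≤
      ((V:ℝ)^j) ^ (1/p) * (rtTreeE V m p F) ^ (1/p) * ∑ i ∈ range j, (((V:ℝ)^(-(1/p)))) ^ (i+1) := by
  have hp0 : 0 < p := by linarith
  have hV0 : (0:ℝ) < V := by positivity
  have hE : 0 ≤ rtTreeE V m p F := by unfold rtTreeE; positivity
  induction j with
  | zero => simp [rtWords, hp0.ne']
  | succ j ih =>
    have ih := ih (by omega)
    rw [sum_range_succ, mul_add]
    have h1 : (∑ u ∈ rtWords V (j+1), |F u - F []| ^ p) =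
      ∑ q ∈ rtWords V j ×ˢ (univ : Finset (Fin V)),
        |(F (q.1 ++ [q.2]) - F q.1) + (F q.1 - F [])| ^ p := by
      rw [rtWords_sum, Finset.sum_product]; simp
    rw [h1]
    refine (Real.Lp_add_le _ _ _ hp).trans ?_
    rw [add_comm]
    gcongr ?_ + ?_
    · have : ∑ q ∈ rtWords V j ×ˢ (univ : Finset (Fin V)), |F q.1 - F []| ^ p
        = V * ∑ u ∈ rtWords V j, |F u - F []| ^ p := by
        rw [Finset.sum_product]; simp [Finset.mul_sum]
      rw [this, Real.mul_rpow (by positivity) (by positivity), pow_succ, mul_comm _ (V:ℝ),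
        Real.mul_rpow (by positivity) (by positivity), mul_assoc, mul_assoc]
      gcongr
      rw [← mul_assoc]; exact ih
    · have : ∑ q ∈ rtWords V j ×ˢ (univ : Finset (Fin V)), |F (q.1 ++ [q.2]) - F q.1| ^ p
        ≤ rtTreeE V m p F := by
        rw [Finset.sum_product, rtTreeE]
        exact Finset.single_le_sum
          (f := fun j => ∑ u ∈ rtWords V j, ∑ β, |F (u ++ [β]) - F u| ^ p)
          (fun i _ => by positivity) (by simp; omega)
      have h2 : ((V:ℝ)^(j+1)) ^ (1/p) * (((V:ℝ)^(-(1/p)))) ^ (j+1) = 1 := by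
        rw [← Real.rpow_natCast, ← Real.rpow_natCast, ← Real.rpow_mul hV0.le,
          ← Real.rpow_mul hV0.le, ← Real.rpow_add hV0]
        convert Real.rpow_zero _ using 2
        ring
      rw [mul_right_comm, h2, one_mul]
      gcongr

noncomputable def rtC (V : ℕ) (p : ℝ) : ℝ := ((1 - (V:ℝ)^(-(1/p)))⁻¹) ^ p

theorem rtTree (V m : ℕ) (hV : 2 ≤ V) (p : ℝ) (hp : 1 ≤ p) (F : List (Fin V) → ℝ) (j : ℕ)
    (hj : j ≤ m) :
    ∑ u ∈ rtWords V j, |F u - F []| ^ p ≤ rtC V p * V ^ j * rtTreeE V m p F := by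
  have hp0 : 0 < p := by linarith
  have hV0 : (0:ℝ) < V := by positivity
  have hV1 : (1:ℝ) < V := by exact_mod_cast hV
  have hE : 0 ≤ rtTreeE V m p F := by unfold rtTreeE; positivity
  have h := rtTree_step V m hV p hp F j hj
  set a := (V:ℝ)^(-(1/p))
  have ha0 : 0 ≤ a := by positivity
  have ha1 : a < 1 := Real.rpow_lt_one_of_one_lt_of_neg hV1 (by simp; positivity)
  have h2 : ∑ i ∈ range j, a ^ (i+1) ≤ (1 - a)⁻¹ := by
    rw [← tsum_geometric_of_lt_one ha0 ha1]
    refine le_trans ?_ ((summable_geometric_of_lt_one ha0 ha1).sum_le_tsum (range j) (fun i _ => by positivity))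
    refine Finset.sum_le_sum fun i _ => ?_
    exact pow_le_pow_of_le_one ha0 ha1.le (by omega)
  have h3 := h.trans (mul_le_mul_of_nonneg_left h2 (by positivity))
  have h4 := Real.rpow_le_rpow (by positivity) h3 hp0.le
  have : 0 ≤ (1-a)⁻¹ := by rw [inv_nonneg]; linarith
  rw [Real.mul_rpow (by positivity) this, Real.mul_rpow (by positivity) (by positivity),
    ← Real.rpow_mul (by positivity), ← Real.rpow_mul (by positivity), ← Real.rpow_mul (by positivity)] at h4
  simp only [one_div, inv_mul_cancel₀ hp0.ne', Real.rpow_one] at h4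
  refine h4.trans (le_of_eq ?_)
  rw [rtC]; simp only [one_div, a]; ring

theorem rtC_nonneg (V : ℕ) (hV : 2 ≤ V) (p : ℝ) (hp : 1 ≤ p) : 0 ≤ rtC V p := by
  have hV1 : (1:ℝ) < V := by exact_mod_cast hV
  have ha1 : (V:ℝ)^(-(1/p)) < 1 := Real.rpow_lt_one_of_one_lt_of_neg hV1 (by simp; positivity)
  apply Real.rpow_nonneg; rw [inv_nonneg]; linarith

theorem rtPath_aux (p : ℝ) (hp : 1 ≤ p) (g : ℕ → ℝ) (L a b : ℕ) (hab : a ≤ b) (hb : b < L) :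
    |g b - g a| ^ p ≤ (L:ℝ) ^ (p-1) * ∑ i ∈ range (L-1), |g i - g (i+1)| ^ p := by
  have h1 : |g b - g a| ≤ ∑ i ∈ Ico a b, |g i - g (i+1)| := by
    rw [← Finset.sum_Ico_sub g hab]
    refine (Finset.abs_sum_le_sum_abs _ _).trans (le_of_eq ?_)
    exact Finset.sum_congr rfl fun i _ => abs_sub_comm _ _
  refine (Real.rpow_le_rpow (abs_nonneg _) h1 (by linarith)).trans ?_
  refine (Real.rpow_sum_le_const_mul_sum_rpow _ _ hp).trans ?_
  have h2 : (#(Ico a b)) ≤ L := by simp; omega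
  have h3 : Ico a b ⊆ range (L-1) := by intro i; simp; omega
  have h4 : 0 ≤ p - 1 := by linarith
  gcongr

theorem rtPath (p : ℝ) (hp : 1 ≤ p) (g : ℕ → ℝ) (L a b : ℕ) (ha : a < L) (hb : b < L) :
    |g b - g a| ^ p ≤ (L:ℝ) ^ (p-1) * ∑ i ∈ range (L-1), |g i - g (i+1)| ^ p := by
  rcases le_total a b with h | h
  · exact rtPath_aux p hp g L a b h hb
  · rw [abs_sub_comm]; exact rtPath_aux p hp g L b a h ha

/-- the triangle inequality for `p`-th powers -/
theorem rtTri (p : ℝ) (hp : 1 ≤ p) (a b c : ℝ) :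
    |a - c| ^ p ≤ 2 ^ (p-1) * (|a - b| ^ p + |b - c| ^ p) := by
  refine (Real.rpow_le_rpow (abs_nonneg _) (abs_sub_le a b c) (by linarith)).trans ?_
  have := Real.rpow_sum_le_const_mul_sum_rpow (univ : Finset (Fin 2)) ![a-b, b-c] hp
  simpa using this

/-- Jensen -/
theorem rtJensen {ι : Type*} (s : Finset ι) (hs : 0 < s.card) (p : ℝ) (hp : 1 ≤ p) (f : ι → ℝ)
    (y : ℝ) :
    |y - (∑ i ∈ s, f i) / s.card| ^ p ≤ (∑ i ∈ s, |y - f i| ^ p) / s.card := by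
  have hc : (0:ℝ) < s.card := by exact_mod_cast hs
  have h0 : y - (∑ i ∈ s, f i) / s.card = (∑ i ∈ s, (y - f i)) / s.card := by
    rw [Finset.sum_sub_distrib]; simp; field_simp
  rw [h0, abs_div, Nat.abs_cast, Real.div_rpow (by positivity) hc.le, div_le_div_iff₀ (by positivity) hc]
  have h1 := (Real.rpow_le_rpow (abs_nonneg _) (Finset.abs_sum_le_sum_abs (fun i => y - f i) s) (by linarith : 0 ≤ p)).trans
    (Real.rpow_sum_le_const_mul_sum_rpow s (fun i => y - f i) hp)
  refine (mul_le_mul_of_nonneg_right h1 hc.le).trans (le_of_eq ?_)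
  have : (s.card:ℝ)^p = (s.card:ℝ)^(p-1) * s.card := by
    rw [Real.rpow_sub_one hc.ne']; field_simp
  rw [this]; ring

theorem rtCenter {W : Type*} [Fintype W] (p : ℝ) (hp : 1 ≤ p) (f : W → ℝ) (hf : ∑ v, f v = 0)
    (c : ℝ) : ∑ v, |f v| ^ p ≤ 2 ^ p * ∑ v, |f v - c| ^ p := by
  rcases Nat.eq_zero_or_pos (Fintype.card W) with h | h
  · have := Fintype.card_eq_zero_iff.1 h; simp
  have hc : (0:ℝ) < Fintype.card W := by exact_mod_cast h
  have h1 := rtJensen (univ : Finset W) h p hp f c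
  rw [hf, zero_div, sub_zero, le_div_iff₀ (by simpa using hc)] at h1
  have h2 : ∀ v, |f v| ^ p ≤ 2 ^ (p-1) * (|f v - c| ^ p + |c|^p) := fun v => by
    have := rtTri p hp (f v) c 0; simpa using this
  refine (Finset.sum_le_sum fun v _ => h2 v).trans ?_
  rw [← Finset.mul_sum, Finset.sum_add_distrib]
  simp only [abs_sub_comm c, Finset.card_univ] at h1
  have h3 : (2:ℝ)^p = 2^(p-1) * 2 := by rw [Real.rpow_sub_one (by norm_num)]; ring
  rw [h3, mul_assoc]
  gcongr
  simp only [Finset.sum_const, Finset.card_univ, nsmul_eq_mul]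
  linarith

/-- The main analytic estimate -/
theorem rtMain (H V m N L : ℕ) (hH : 2 ≤ H) (hV : 2 ≤ V) (hN : 0 < N) (hL : L = N * H ^ m)
    (p : ℝ) (hp : 1 ≤ p)
    (hLp : (L:ℝ) ^ p ≤ 2 ^ p * ((H:ℝ) ^ m * (V:ℝ) ^ m))
    (F : ℕ → List (Fin V) → ℝ) (G : List (Fin V) → ℕ → ℝ) (pos : ℕ → List (Fin V) → ℕ)
    (hpos : ∀ i < N, ∀ w ∈ rtWords V m, pos i w < L ∧ G w (pos i w) = F i w)
    (hinj : ∀ w ∈ rtWords V m, ∀ i < N, ∀ i' < N, pos i w = pos i' w → i = i')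
    (E : ℝ) (hE0 : 0 ≤ E)
    (hvert : ∑ i ∈ range N, rtTreeE V m p (F i) ≤ E)
    (hhor : ∑ w ∈ rtWords V m, ∑ y ∈ range (L-1), |G w y - G w (y+1)| ^ p ≤ E) :
    ∃ c : ℝ, ∑ w ∈ rtWords V m, ∑ y ∈ range L, |G w y - c| ^ p +
      ∑ j ∈ range m, ∑ u ∈ rtWords V j, ∑ i ∈ range N, |F i u - c| ^ p ≤
      ((2:ℝ)^(p-1) * (2^p + rtC V p) + 2^(p-1) * (rtC V p + 2^(p-1) * (rtC V p +
        2^(p-1) * (2^p + rtC V p)))) * ((H:ℝ) ^ m * (V:ℝ) ^ m) * E := by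
  have hC := rtC_nonneg V hV p hp
  have hN0 : (0:ℝ) < N := by exact_mod_cast hN
  have hH1 : (1:ℝ) ≤ (H:ℝ)^m := one_le_pow₀ (by exact_mod_cast (by omega : 1 ≤ H))
  have hV0 : (0:ℝ) < (V:ℝ)^m := by positivity
  have hLpos : 0 < L := by rw [hL]; positivity
  have hL0 : (0:ℝ) < L := by exact_mod_cast hLpos
  set C := rtC V p with hCdef
  set A : ℝ := 2^(p-1) with hA
  have hA0 : 0 < A := by positivity
  set D : ℝ := (H:ℝ)^m * (V:ℝ)^m with hD
  have hVD : (V:ℝ)^m ≤ D := by rw [hD]; nlinarith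
  have hD0 : 0 < D := by positivity
  set c : ℝ := (∑ i ∈ range N, F i []) / N with hc
  -- tree estimate
  have htree : ∀ j ≤ m, ∑ u ∈ rtWords V j, ∑ i ∈ range N, |F i u - F i []| ^ p ≤ C * V^j * E := by
    intro j hj
    rw [Finset.sum_comm]
    refine (Finset.sum_le_sum fun i _ => rtTree V m hV p hp (F i) j hj).trans ?_
    rw [← Finset.mul_sum]
    gcongr
  -- bottom estimate
  set BOT := ∑ w ∈ rtWords V m, ∑ y ∈ range L, |G w y - c| ^ p with hBOT
  have hbot : BOT ≤ A * (2^p + C) * D * E := by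
    have h1 : ∀ w ∈ rtWords V m, ∀ y ∈ range L, |G w y - c| ^ p ≤
        A * ((L:ℝ)^(p-1) * ∑ y ∈ range (L-1), |G w y - G w (y+1)| ^ p) +
        A * ((∑ i ∈ range N, |F i w - F i []| ^ p) / N) := by
      intro w hw y hy
      have := rtJensen (range N) (by simpa using hN) p hp (fun i => F i []) (G w y)
      rw [Finset.card_range] at this
      refine this.trans ?_
      rw [div_le_iff₀ hN0]
      have h2 : ∀ i ∈ range N, |G w y - F i []| ^ p ≤
        A * ((L:ℝ)^(p-1) * ∑ y ∈ range (L-1), |G w y - G w (y+1)| ^ p) + A * |F i w - F i []| ^ p := by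
        intro i hi
        obtain ⟨h3, h4⟩ := hpos i (by simpa using hi) w hw
        refine (rtTri p hp _ (F i w) _).trans ?_
        rw [mul_add]
        gcongr
        rw [← h4]
        exact rtPath p hp _ L _ _ h3 (by simpa using hy)
      refine (Finset.sum_le_sum h2).trans (le_of_eq ?_)
      simp only [Finset.sum_add_distrib, ← Finset.mul_sum (range N), sum_const, card_range, nsmul_eq_mul]
      field_simp
    have h5 : BOT ≤ A * (L:ℝ)^p * E + A * ((H:ℝ)^m) * (C * V^m * E) := by
      refine (Finset.sum_le_sum fun w hw => Finset.sum_le_sum (h1 w hw)).trans ?_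
      simp only [sum_const, card_range, nsmul_eq_mul]
      rw [← Finset.mul_sum, Finset.sum_add_distrib, ← Finset.mul_sum, ← Finset.mul_sum, mul_add,
        ← Finset.mul_sum, ← Finset.sum_div]
      have e1 : (L:ℝ)^p = L * (L:ℝ)^(p-1) := by rw [Real.rpow_sub_one hL0.ne']; field_simp
      have e2 : (H:ℝ)^m = L / N := by rw [hL]; push_cast; field_simp
      rw [e1, e2]
      have t := htree m le_rfl
      gcongr ?_ + ?_
      · calc _ = A * (L * (L:ℝ)^(p-1)) * ∑ w ∈ rtWords V m, ∑ y ∈ range (L-1), |G w y - G w (y+1)| ^ p := by ring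
          _ ≤ _ := by gcongr
      · calc _ = A * (L / N) * ∑ u ∈ rtWords V m, ∑ i ∈ range N, |F i u - F i []| ^ p := by ring
          _ ≤ _ := by gcongr
    refine h5.trans ?_
    calc _ ≤ A * (2^p * D) * E + A * ((H:ℝ)^m) * (C * V^m * E) := by gcongr
      _ = _ := by rw [hD]; ring
  -- roots
  have hroot : (V:ℝ)^m * ∑ i ∈ range N, |F i [] - c| ^ p ≤ A * (C * V^m * E + BOT) := by
    have h1 : (V:ℝ)^m * ∑ i ∈ range N, |F i [] - c| ^ p =
      ∑ w ∈ rtWords V m, ∑ i ∈ range N, |F i [] - c| ^ p := by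
      simp [card_rtWords]
    have h2 : ∑ w ∈ rtWords V m, ∑ i ∈ range N, |F i w - c| ^ p ≤ BOT := by
      refine Finset.sum_le_sum fun w hw => ?_
      have : ∑ i ∈ range N, |F i w - c| ^ p = ∑ y ∈ (range N).image (fun i => pos i w), |G w y - c| ^ p := by
        rw [Finset.sum_image]
        · refine Finset.sum_congr rfl fun i hi => ?_
          rw [(hpos i (by simpa using hi) w hw).2]
        · intro i hi i' hi' h
          exact hinj w hw i (by simpa using hi) i' (by simpa using hi') h
      rw [this]
      refine Finset.sum_le_sum_of_subset_of_nonneg ?_ fun _ _ _ => by positivity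
      intro y hy
      obtain ⟨i, hi, rfl⟩ := Finset.mem_image.1 hy
      simpa using (hpos i (by simpa using hi) w hw).1
    rw [h1]
    calc _ ≤ ∑ w ∈ rtWords V m, ∑ i ∈ range N, A * (|F i w - F i []| ^ p + |F i w - c| ^ p) := by
          refine Finset.sum_le_sum fun w hw => Finset.sum_le_sum fun i hi => ?_
          have := rtTri p hp (F i []) (F i w) c
          rwa [abs_sub_comm (F i []) (F i w)] at this
      _ = A * (∑ w ∈ rtWords V m, ∑ i ∈ range N, |F i w - F i []| ^ p +
            ∑ w ∈ rtWords V m, ∑ i ∈ range N, |F i w - c| ^ p) := by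
          simp only [← Finset.mul_sum, Finset.sum_add_distrib]
      _ ≤ _ := by gcongr; exact htree m le_rfl
  -- top
  have hgeom : ∑ j ∈ range m, (V:ℝ)^j ≤ (V:ℝ)^m := by
    clear * - hV
    have h2 : (2:ℝ) ≤ V := by exact_mod_cast hV
    induction m with
    | zero => simp
    | succ m ih =>
      rw [sum_range_succ, pow_succ]
      have : (0:ℝ) < (V:ℝ)^m := by positivity
      nlinarith
  set R := ∑ i ∈ range N, |F i [] - c| ^ p with hR
  have hR0 : 0 ≤ R := by positivity
  have htop : ∑ j ∈ range m, ∑ u ∈ rtWords V j, ∑ i ∈ range N, |F i u - c| ^ p ≤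
      A * (C * V^m * E + V^m * R) := by
    calc _ ≤ ∑ j ∈ range m, A * (C * E + R) * (V:ℝ)^j := by
          refine Finset.sum_le_sum fun j hj => ?_
          have hj' : j ≤ m := by simp at hj; omega
          calc _ ≤ ∑ u ∈ rtWords V j, ∑ i ∈ range N, A * (|F i u - F i []| ^ p + |F i [] - c| ^ p) :=
                Finset.sum_le_sum fun w hw => Finset.sum_le_sum fun i hi => rtTri p hp _ _ _
            _ = A * (∑ u ∈ rtWords V j, ∑ i ∈ range N, |F i u - F i []| ^ p + V^j * R) := by
                simp only [← Finset.mul_sum, Finset.sum_add_distrib]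
                simp [card_rtWords, R]
            _ ≤ A * (C * V^j * E + V^j * R) := by gcongr; exact htree j hj'
            _ = _ := by ring
      _ = A * (C * E + R) * ∑ j ∈ range m, (V:ℝ)^j := by rw [Finset.mul_sum]
      _ ≤ A * (C * E + R) * (V:ℝ)^m := by gcongr
      _ = _ := by ring
  refine ⟨c, ?_⟩
  calc _ ≤ A * (2^p + C) * D * E + A * (C * D * E + A * (C * D * E + A * (2^p + C) * D * E)) := by
        refine add_le_add hbot (htop.trans ?_)
        have e : C * V^m * E ≤ C * D * E := by gcongr
        have e2 := mul_le_mul_of_nonneg_left (add_le_add e hbot) hA0.le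
        exact mul_le_mul_of_nonneg_left (add_le_add e (hroot.trans e2)) hA0.le
    _ = _ := by ring

open Classical in
/-- the row over `v` -/
noncomputable def rtRow {H V : ℕ} (S : Set (RTVert H V)) (v : List (Fin V)) :
    Finset (List (Fin H)) :=
  (rtWords H v.length).filter (fun h => (h, v) ∈ S)

theorem mem_rtRow {H V : ℕ} {S : Set (RTVert H V)} (hS : ∀ x ∈ S, x.1.length = x.2.length)
    (v : List (Fin V)) (h : List (Fin H)) : h ∈ rtRow S v ↔ (h, v) ∈ S := by
  simp only [rtRow, Finset.mem_filter, mem_rtWords, and_iff_right_iff_imp]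
  intro hh
  exact hS _ hh

/-- enumeration of the row over `v` in lexicographic order -/
noncomputable def rtEn {H V : ℕ} (S : Set (RTVert H V)) (v : List (Fin V)) (i : ℕ) :
    List (Fin H) :=
  if h : i < (rtRow S v).card then (rtRow S v).orderEmbOfFin rfl ⟨i, h⟩ else []

theorem rtEn_mem {H V : ℕ} {S : Set (RTVert H V)} (hS : ∀ x ∈ S, x.1.length = x.2.length)
    (v : List (Fin V)) (i : ℕ) (hi : i < (rtRow S v).card) : (rtEn S v i, v) ∈ S := by
  rw [← mem_rtRow hS, rtEn, dif_pos hi]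
  exact Finset.orderEmbOfFin_mem _ _ _

theorem rtEn_lt {H V : ℕ} {S : Set (RTVert H V)}
    (v : List (Fin V)) (i j : ℕ) (hi : i < (rtRow S v).card) (hj : j < (rtRow S v).card) :
    rtEn S v i < rtEn S v j ↔ i < j := by
  rw [rtEn, rtEn, dif_pos hi, dif_pos hj]
  simp

theorem rtEn_inj {H V : ℕ} {S : Set (RTVert H V)}
    (v : List (Fin V)) (i j : ℕ) (hi : i < (rtRow S v).card) (hj : j < (rtRow S v).card)
    (h : rtEn S v i = rtEn S v j) : i = j := by
  rw [rtEn, rtEn, dif_pos hi, dif_pos hj] at h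
  simpa using h

theorem rtEn_surj {H V : ℕ} {S : Set (RTVert H V)} (hS : ∀ x ∈ S, x.1.length = x.2.length)
    (v : List (Fin V)) (h : List (Fin H)) (hh : (h, v) ∈ S) :
    ∃ i < (rtRow S v).card, rtEn S v i = h := by
  rw [← mem_rtRow hS, ← Finset.mem_coe, ← Finset.range_orderEmbOfFin _ rfl] at hh
  obtain ⟨⟨i, hi⟩, rfl⟩ := hh
  exact ⟨i, hi, by rw [rtEn, dif_pos hi]⟩

theorem rtEn_adj {H V : ℕ} {S : Set (RTVert H V)} {Γ : SimpleGraph (RTVert H V)}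
    (hΓ : IsRoundTreeGraph H V S Γ)
    (v : List (Fin V)) (i : ℕ) (hi : i + 1 < (rtRow S v).card) :
    Γ.Adj (rtEn S v i, v) (rtEn S v (i+1), v) := by
  obtain ⟨-, hS, -, -, h4, -⟩ := hΓ
  refine h4 _ _ v (rtEn_mem hS v i (by omega)) (rtEn_mem hS v _ hi) ?_ ?_
  · exact (rtEn_lt v i (i+1) (by omega) hi).2 (by omega)
  · rintro ⟨w, hw, h1, h2⟩
    obtain ⟨j, hj, rfl⟩ := rtEn_surj hS v w hw
    have h1 := (rtEn_lt v _ _ (by omega) hj).1 h1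
    have h2 := (rtEn_lt v _ _ hj hi).1 h2
    omega

theorem rtPrefix {H V : ℕ} {S : Set (RTVert H V)} {Γ : SimpleGraph (RTVert H V)}
    (hΓ : IsRoundTreeGraph H V S Γ) (v w : List (Fin V)) :
    ∀ h : List (Fin H), (h, v ++ w) ∈ S → (h.take v.length, v) ∈ S := by
  obtain ⟨-, hS, h2, -, -, -⟩ := hΓ
  induction w using List.reverseRecOn with
  | nil =>
    intro h hh
    have := hS _ hh
    simp only [List.append_nil] at this hh
    rwa [← this, List.take_length]
  | append_singleton w β ih =>
    intro h hh
    have hl := hS _ hh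
    simp at hl
    have hne : h ≠ [] := by rintro rfl; simp at hl
    rw [← List.dropLast_append_getLast hne, ← List.append_assoc] at hh
    have := ih _ (h2 _ _ _ _ hh).1
    rw [List.dropLast_eq_take, List.take_take, min_eq_left (by omega)] at this
    exact this

theorem rtDown {H V : ℕ} {S : Set (RTVert H V)} {Γ : SimpleGraph (RTVert H V)}
    (hΓ : IsRoundTreeGraph H V S Γ) (z : Fin H) (hz : (z:ℕ) = 0) (h : List (Fin H))
    (v : List (Fin V)) (hh : (h, v) ∈ S) (β : Fin V) : (h ++ [z], v ++ [β]) ∈ S := by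
  obtain ⟨-, -, -, h3, -, -⟩ := hΓ
  obtain ⟨Δ, hΔ, -, h⟩ := h3 _ _ hh β
  rw [h]; omega

theorem rtDowns {H V : ℕ} {S : Set (RTVert H V)} {Γ : SimpleGraph (RTVert H V)}
    (hΓ : IsRoundTreeGraph H V S Γ) (z : Fin H) (hz : (z:ℕ) = 0) (h : List (Fin H))
    (v : List (Fin V)) (hh : (h, v) ∈ S) (w : List (Fin V)) :
    (h ++ List.replicate w.length z, v ++ w) ∈ S := by
  induction w using List.reverseRecOn with
  | nil => simpa using hh
  | append_singleton w β ih =>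
    have := rtDown hΓ z hz _ _ ih β
    simpa [List.replicate_succ'] using this

theorem rtRow_card {H V : ℕ} {S : Set (RTVert H V)} {Γ : SimpleGraph (RTVert H V)}
    (hΓ : IsRoundTreeGraph H V S Γ) (hH : 2 ≤ H) (v : List (Fin V)) :
    2 ^ v.length ≤ (rtRow S v).card := by
  have hΓ' := hΓ
  obtain ⟨h0, hS, -, h3, -, -⟩ := hΓ
  induction v using List.reverseRecOn with
  | nil =>
    simp only [List.length_nil, pow_zero]
    exact Finset.card_pos.2 ⟨[], (mem_rtRow hS _ _).2 h0⟩
  | append_singleton v β ih =>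
    let f : Fin 2 → Fin H := fun b => ⟨b, by omega⟩
    have : ((rtRow S v ×ˢ (univ : Finset (Fin 2))).image (fun q => q.1 ++ [f q.2])).card ≤
        (rtRow S (v ++ [β])).card := by
      refine Finset.card_le_card ?_
      intro x hx
      simp only [mem_image, mem_product, mem_univ, and_true, Prod.exists] at hx
      obtain ⟨a, b, ha, rfl⟩ := hx
      rw [mem_rtRow hS] at ha ⊢
      obtain ⟨Δ, hΔ, -, h⟩ := h3 _ _ ha β
      rw [h]; simp only [f]; omega
    rw [Finset.card_image_of_injective, Finset.card_product] at this
    · simp only [List.length_append, List.length_singleton, pow_succ]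
      simp at this
      omega
    · rintro ⟨a, b⟩ ⟨c, d⟩ h
      simpa [f, Fin.ext_iff] using h

theorem rtLex {n : ℕ} (a b c d : List (Fin n)) (hl : a.length = b.length) (h : a ++ c < b ++ d) :
    a < b ∨ (a = b ∧ c < d) := by
  induction a generalizing b with
  | nil =>
    have : b = [] := by simpa using hl.symm
    subst this; simpa using h
  | cons x a ih =>
    cases b with
    | nil => simp at hl
    | cons y b =>
      simp only [List.cons_append, List.cons_lt_cons_iff] at h ⊢
      rcases h with h | ⟨rfl, h⟩
      · exact Or.inl (Or.inl h)
      · rcases ih b (by simpa using hl) h with h' | ⟨rfl, h'⟩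
        · exact Or.inl (Or.inr ⟨rfl, h'⟩)
        · exact Or.inr ⟨rfl, h'⟩

theorem rtLexZero {n : ℕ} (z : Fin n) (hz : (z:ℕ) = 0) (m : ℕ) (t : List (Fin n))
    (ht : t.length = m) : ¬ t < List.replicate m z := by
  induction t generalizing m with
  | nil => subst ht; simp
  | cons x t ih =>
    subst ht
    simp only [List.length_cons, List.replicate_succ, List.cons_lt_cons_iff, not_or, not_and]
    refine ⟨?_, fun _ => ih _ rfl⟩
    rw [Fin.lt_def]; omega

theorem rtPos {H V : ℕ} {S : Set (RTVert H V)} {Γ : SimpleGraph (RTVert H V)}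
    (hΓ : IsRoundTreeGraph H V S Γ) (z : Fin H) (hz : (z:ℕ) = 0) (v w : List (Fin V)) (i N : ℕ)
    (hi : i < N) (hN : N ≤ (rtRow S v).card) :
    ∃ y < N * H ^ w.length, y < (rtRow S (v ++ w)).card ∧
      rtEn S (v ++ w) y = rtEn S v i ++ List.replicate w.length z := by
  have hΓ' := hΓ
  obtain ⟨-, hS, -, -, -, -⟩ := hΓ
  have hx := rtEn_mem hS v i (by omega)
  obtain ⟨y, hy, hye⟩ := rtEn_surj hS _ _ (rtDowns hΓ' z hz _ _ hx w)
  refine ⟨y, ?_, hy, hye⟩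
  have h1 : ((range y).image (rtEn S (v ++ w))).card = y := by
    rw [Finset.card_image_of_injOn, card_range]
    intro a ha b hb hab
    simp at ha hb
    exact rtEn_inj _ a b (by omega) (by omega) hab
  have h2 : ((range y).image (rtEn S (v ++ w))) ⊆
      (range i ×ˢ rtWords H w.length).image (fun q => rtEn S v q.1 ++ q.2) := by
    intro t ht
    obtain ⟨y', hy', rfl⟩ := Finset.mem_image.1 ht
    have hy'' : y' < y := by simpa using hy'
    have hlt := (rtEn_lt (v ++ w) y' y (by omega) hy).2 hy''
    have hm := rtEn_mem hS (v ++ w) y' (by omega)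
    set t := rtEn S (v ++ w) y'
    have hlen := hS _ hm
    simp only [List.length_append] at hlen
    have hp := rtPrefix hΓ' v w t hm
    rw [hye, ← List.take_append_drop v.length t] at hlt
    obtain ⟨i', hi', hie⟩ := rtEn_surj hS _ _ hp
    have hxl := hS _ hx
    simp only at hxl
    have hdl : (t.drop v.length).length = w.length := by simp; omega
    rcases rtLex _ _ _ _ (by rw [hxl]; simp; omega) hlt with h | ⟨-, h⟩
    · rw [← hie, rtEn_lt v i' i hi' (by omega)] at h
      refine Finset.mem_image.2 ⟨(i', t.drop v.length), ?_, ?_⟩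
      · simp only [mem_product, mem_range, mem_rtWords]; exact ⟨h, hdl⟩
      · simp only [hie, List.take_append_drop]
    · exact absurd h (rtLexZero z hz _ _ hdl)
  have h3 := (Finset.card_le_card h2).trans Finset.card_image_le
  rw [h1, Finset.card_product, card_range, card_rtWords] at h3
  refine lt_of_le_of_lt h3 ?_
  have : 0 < H := by have := z.2; omega
  exact Nat.mul_lt_mul_of_pos_right hi (by positivity)

/-- edge energy -/
theorem rtEdge {W : Type*} [DecidableEq W] (Γ : SimpleGraph W) (s : Finset W) (p : ℝ) (hp : 1 ≤ p)
    (g : W → ℝ) {ι : Type*} (I : Finset ι) (a b : ι → W)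
    (ha : ∀ i ∈ I, a i ∈ s) (hb : ∀ i ∈ I, b i ∈ s) (hab : ∀ i ∈ I, Γ.Adj (a i) (b i))
    (hinj : ∀ i ∈ I, ∀ j ∈ I, a i = a j → b i = b j → i = j)
    (hasym : ∀ i ∈ I, ∀ j ∈ I, a i = b j → b i = a j → False) :
    ∑ i ∈ I, |g (a i) - g (b i)| ^ p ≤
      (gradLpNorm (Γ.comap (fun x : s => (x : W))) p (fun x : s => g x)) ^ p := by
  classical
  have hp0 : 0 < p := by linarith
  unfold gradLpNorm
  rw [← Real.rpow_mul, one_div, inv_mul_cancel₀ hp0.ne', Real.rpow_one]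
  · let e : I → Sym2 s := fun i => s(⟨a i, ha i i.2⟩, ⟨b i, hb i i.2⟩)
    have he : Function.Injective e := by
      intro i j h
      simp only [e, Sym2.eq_iff, Subtype.mk.injEq] at h
      rcases h with ⟨h1, h2⟩ | ⟨h1, h2⟩
      · exact Subtype.ext (hinj i i.2 j j.2 h1 h2)
      · exact (hasym i i.2 j j.2 h1 h2).elim
    rw [← Finset.sum_coe_sort I]
    calc _ = ∑ q ∈ (univ : Finset I).image e, Sym2.lift ⟨fun x y : s => |g x - g y| ^ p,
              fun x y => by show |g x - g y| ^ p = |g y - g x| ^ p; rw [abs_sub_comm]⟩ q := by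
            rw [Finset.sum_image fun i _ j _ h => he h]
            rfl
      _ ≤ _ := by
        refine Finset.sum_le_sum_of_subset_of_nonneg ?_ ?_
        · intro q hq
          obtain ⟨i, -, rfl⟩ := Finset.mem_image.1 hq
          simp only [e, SimpleGraph.mem_edgeFinset, SimpleGraph.mem_edgeSet, SimpleGraph.comap_adj]
          exact hab i i.2
        · intro q _ _
          induction q with
          | _ x y => simp only [Sym2.lift_mk]; positivity
  · refine Finset.sum_nonneg fun q _ => ?_
    induction q with
    | _ x y => simp only [Sym2.lift_mk]; positivity

theorem gradLpNorm_nonneg' {W : Type*} [Fintype W] (G : SimpleGraph W) (p : ℝ)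
    (f : W → ℝ) : 0 ≤ gradLpNorm G p f := by
  unfold gradLpNorm
  refine Real.rpow_nonneg (Finset.sum_nonneg fun q _ => ?_) _
  induction q with
  | _ x y => simp only [Sym2.lift_mk]; positivity

theorem rtPoincare {W : Type*} [Fintype W] (G : SimpleGraph W) (p : ℝ) (hp : 1 ≤ p)
    (hW : 2 ≤ Fintype.card W) (A : ℝ) (hA : 0 < A)
    (h : ∀ f : W → ℝ, ∑ v, f v = 0 → ∑ v, |f v| ^ p ≤ A * (gradLpNorm G p f) ^ p) :
    A ^ (-(1/p)) ≤ poincareConst G p := by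
  classical
  have hp0 : 0 < p := by linarith
  unfold poincareConst
  refine le_csInf ?_ ?_
  · obtain ⟨a, b, hab⟩ := Fintype.one_lt_card_iff.1 hW
    refine ⟨_, fun v => (if v = a then 1 else 0) - (if v = b then 1 else 0), ?_, ?_, rfl⟩
    · simp [Finset.sum_sub_distrib]
    · intro h0
      have := congrFun h0 a
      simp [hab] at this
  · rintro c ⟨f, hf, hf0, rfl⟩
    have h1 := h f hf
    have hpos : 0 < ∑ v, |f v| ^ p := by
      obtain ⟨v, hv⟩ := Function.ne_iff.1 hf0
      refine Finset.sum_pos' (fun _ _ => by positivity) ⟨v, mem_univ _, ?_⟩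
      have : 0 < |f v| := abs_pos.2 hv
      positivity
    have hg := gradLpNorm_nonneg' G p f
    unfold lpNorm
    rw [le_div_iff₀ (by positivity)]
    have h2 := Real.rpow_le_rpow hpos.le h1 (by positivity : 0 ≤ 1/p)
    rw [Real.mul_rpow hA.le (by positivity), ← Real.rpow_mul hg, mul_one_div_cancel hp0.ne',
      Real.rpow_one] at h2
    calc _ ≤ A ^ (-(1/p)) * (A ^ (1/p) * gradLpNorm G p f) := by gcongr
      _ = _ := by rw [← mul_assoc, ← Real.rpow_add hA]; simp

/-- the constant of the main estimate -/
noncomputable def rtK (V : ℕ) (p : ℝ) : ℝ :=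
  ((2:ℝ)^(p-1) * (2^p + rtC V p) + 2^(p-1) * (rtC V p + 2^(p-1) * (rtC V p +
        2^(p-1) * (2^p + rtC V p))))

theorem rtSumU (V m : ℕ) (φ : List (Fin V) → ℝ) :
    ∑ u ∈ (range m).biUnion (rtWords V), φ u = ∑ j ∈ range m, ∑ u ∈ rtWords V j, φ u := by
  refine Finset.sum_biUnion ?_
  intro a _ b _ hab
  simp only [Function.onFun]
  rw [Finset.disjoint_left]
  intro u hu hu'
  rw [mem_rtWords] at hu hu'
  omega

theorem rtGeomNat (V m : ℕ) (hV : 2 ≤ V) : ∑ j ∈ range m, V ^ j ≤ V ^ m := by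
  induction m with
  | zero => simp
  | succ m ih =>
    rw [sum_range_succ, pow_succ]
    have : V ^ m * 2 ≤ V ^ m * V := Nat.mul_le_mul_left _ hV
    omega

theorem rtSumImage {α ι : Type*} [DecidableEq α] (I : Finset ι) (f : ι → α) (φ : α → ℝ)
    (h : ∀ x, 0 ≤ φ x) : ∑ x ∈ I.image f, φ x ≤ ∑ i ∈ I, φ (f i) :=
  Finset.sum_image_le_of_nonneg (fun x _ => h x)

theorem rtGraph {H V : ℕ} {S : Set (RTVert H V)} {Γ : SimpleGraph (RTVert H V)}
    (hΓ : IsRoundTreeGraph H V S Γ) (hH : 2 ≤ H) (hV : 2 ≤ V) (m N L : ℕ) (hm : 1 ≤ m)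
    (hN : 0 < N) (hL : L = N * H ^ m) (p : ℝ) (hp : 1 ≤ p)
    (hLp : (L:ℝ) ^ p ≤ 2 ^ p * ((H:ℝ) ^ m * (V:ℝ) ^ m)) :
    ∃ s : Finset (RTVert H V), V ^ m * L ≤ s.card ∧ s.card ≤ 2 * (V ^ m * L) ∧
      (2 ^ p * (rtK V p * ((H:ℝ) ^ m * (V:ℝ) ^ m))) ^ (-(1/p)) ≤
        poincareConst (Γ.comap (fun x : s => (x : RTVert H V))) p := by
  classical
  have hΓ' := hΓ
  obtain ⟨-, hS, h2, -, -, -⟩ := hΓ'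
  let z : Fin H := ⟨0, by omega⟩
  have hz : (z:ℕ) = 0 := rfl
  let v : List (Fin V) := List.replicate L ⟨0, by omega⟩
  have hv : v.length = L := by simp [v]
  have hHm : 1 ≤ H ^ m := Nat.one_le_pow _ _ (by omega)
  have hNL : N ≤ L := by rw [hL]; nlinarith
  have hrowN : N ≤ (rtRow S v).card := by
    have := rtRow_card hΓ hH v
    have := @Nat.lt_two_pow_self L
    rw [hv] at *; omega
  have hrowL : ∀ w : List (Fin V), L ≤ (rtRow S (v ++ w)).card := by
    intro w
    have h1 := rtRow_card hΓ hH (v ++ w)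
    have h2 := @Nat.lt_two_pow_self L
    have h3 : 2 ^ L ≤ 2 ^ (v ++ w).length := Nat.pow_le_pow_right (by norm_num) (by simp [hv])
    omega
  let bot : List (Fin V) × ℕ → RTVert H V := fun q => (rtEn S (v ++ q.1) q.2, v ++ q.1)
  let top : List (Fin V) × ℕ → RTVert H V :=
    fun q => (rtEn S v q.2 ++ List.replicate q.1.length z, v ++ q.1)
  have hbotinj : ∀ a b, a.2 < L → b.2 < L → bot a = bot b → a = b := by
    rintro ⟨w, i⟩ ⟨w', i'⟩ ha hb h
    simp only [bot, Prod.mk.injEq, List.append_cancel_left_eq] at h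
    obtain ⟨h1, rfl⟩ := h
    rw [rtEn_inj (v ++ w) i i' (lt_of_lt_of_le ha (hrowL w)) (lt_of_lt_of_le hb (hrowL w)) h1]
  have htopinj : ∀ a b, a.2 < N → b.2 < N → top a = top b → a = b := by
    rintro ⟨w, i⟩ ⟨w', i'⟩ ha hb h
    simp only [top, Prod.mk.injEq, List.append_cancel_left_eq] at h
    obtain ⟨h1, rfl⟩ := h
    rw [rtEn_inj v i i' (lt_of_lt_of_le ha hrowN) (lt_of_lt_of_le hb hrowN)
      (List.append_cancel_right h1)]
  have hpos : ∀ (i : ℕ) (w : List (Fin V)), ∃ y, i < N → w ∈ rtWords V m →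
      y < L ∧ bot (w, y) = top (w, i) := by
    intro i w
    by_cases hi : i < N
    · by_cases hw : w ∈ rtWords V m
      · obtain ⟨y, hy1, hy2, hy3⟩ := rtPos hΓ z hz v w i N hi hrowN
        rw [mem_rtWords] at hw
        refine ⟨y, fun _ _ => ⟨by rwa [hL, ← hw], ?_⟩⟩
        simp only [bot, top, hy3]
      · exact ⟨0, fun _ h => absurd h hw⟩
    · exact ⟨0, fun h => absurd h hi⟩
  choose pos hpos using hpos
  let U := (range m).biUnion (rtWords V)
  have hU : ∀ u, u ∈ U ↔ u.length < m := by
    intro u; simp only [U, mem_biUnion, mem_range, mem_rtWords]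
    exact ⟨by rintro ⟨a, h, rfl⟩; exact h, fun h => ⟨_, h, rfl⟩⟩
  let s : Finset (RTVert H V) := (rtWords V m ×ˢ range L).image bot ∪ (U ×ˢ range N).image top
  have hbs : ∀ w y, w.length = m → y < L → bot (w, y) ∈ s := by
    intro w y hw hy
    refine Finset.mem_union_left _ (Finset.mem_image_of_mem _ ?_)
    simp [mem_rtWords, hw, hy]
  have hts : ∀ u i, u.length ≤ m → i < N → top (u, i) ∈ s := by
    intro u i hu hi
    rcases hu.lt_or_eq with h | h
    · refine Finset.mem_union_right _ (Finset.mem_image_of_mem _ ?_)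
      simp [hU, h, hi]
    · obtain ⟨h1, h2⟩ := hpos i u hi ((mem_rtWords _ _ _).2 h)
      rw [← h2]; exact hbs _ _ h h1
  have hc1 : V ^ m * L ≤ s.card := by
    have : ((rtWords V m ×ˢ range L).image bot).card = V ^ m * L := by
      rw [Finset.card_image_of_injOn, card_product, card_rtWords, card_range]
      intro a ha b hb hab
      simp at ha hb
      exact hbotinj a b ha.2 hb.2 hab
    rw [← this]
    exact Finset.card_le_card Finset.subset_union_left
  have hc2 : s.card ≤ 2 * (V ^ m * L) := by
    refine (Finset.card_union_le _ _).trans ?_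
    have h1 : ((rtWords V m ×ˢ range L).image bot).card ≤ V ^ m * L := by
      refine Finset.card_image_le.trans ?_
      rw [card_product, card_rtWords, card_range]
    have h2 : ((U ×ˢ range N).image top).card ≤ V ^ m * L := by
      refine Finset.card_image_le.trans ?_
      rw [card_product, card_range]
      refine Nat.mul_le_mul ?_ hNL
      refine Finset.card_biUnion_le.trans ?_
      simp only [card_rtWords]
      exact rtGeomNat V m hV
    omega
  refine ⟨s, hc1, hc2, ?_⟩
  have hC := rtC_nonneg V hV p hp
  have hK : 0 < rtK V p := by unfold rtK; positivity
  refine rtPoincare _ p hp ?_ _ (by positivity) ?_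
  · rw [Fintype.card_coe]
    refine le_trans ?_ hc1
    have : 2 ≤ V ^ m := hV.trans (Nat.le_self_pow (by omega) V)
    nlinarith
  intro f hf
  let g : RTVert H V → ℝ := fun x => if h : x ∈ s then f ⟨x, h⟩ else 0
  have hfg : f = fun x : s => g x := by
    funext x; simp [g]
  set E := (gradLpNorm (Γ.comap (fun x : s => (x : RTVert H V))) p f) ^ p with hE
  have hE0 : 0 ≤ E := Real.rpow_nonneg (gradLpNorm_nonneg' _ _ _) _
  have hvert : ∑ i ∈ range N, rtTreeE V m p (fun u => g (top (u, i))) ≤ E := by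
    have h := rtEdge Γ s p hp g ((U ×ˢ (univ : Finset (Fin V))) ×ˢ range N)
      (fun q => top (q.1.1 ++ [q.1.2], q.2)) (fun q => top (q.1.1, q.2)) ?_ ?_ ?_ ?_ ?_
    · rw [← hfg] at h
      refine le_trans (le_of_eq ?_) h
      rw [Finset.sum_product_right]
      refine Finset.sum_congr rfl fun i _ => ?_
      rw [Finset.sum_product, rtSumU]
      rfl
    · rintro ⟨⟨u, β⟩, i⟩ hq
      simp only [mem_product, hU, mem_univ, mem_range, and_true] at hq
      exact hts _ _ (by simp; omega) hq.2
    · rintro ⟨⟨u, β⟩, i⟩ hq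
      simp only [mem_product, hU, mem_univ, mem_range, and_true] at hq
      exact hts _ _ hq.1.le hq.2
    · rintro ⟨⟨u, β⟩, i⟩ hq
      simp only [mem_product, hU, mem_univ, mem_range, and_true] at hq
      have h3 := rtDowns hΓ z hz _ _ (rtEn_mem hS v i (lt_of_lt_of_le hq.2 hrowN)) u
      have h4 := (h2 _ _ _ _ (rtDown hΓ z hz _ _ h3 β)).2.symm
      simpa [top, List.replicate_succ'] using h4
    · rintro ⟨⟨u, β⟩, i⟩ hq ⟨⟨u', β'⟩, i'⟩ hq' e1 e2
      simp only [mem_product, hU, mem_univ, mem_range, and_true] at hq hq'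
      have e3 := htopinj _ _ hq.2 hq'.2 e1
      simp only [Prod.mk.injEq] at e3
      simpa using e3
    · rintro ⟨⟨u, β⟩, i⟩ hq ⟨⟨u', β'⟩, i'⟩ hq' e1 e2
      simp only [mem_product, hU, mem_univ, mem_range, and_true] at hq hq'
      have e3 := htopinj _ _ hq.2 hq'.2 e1
      have e4 := htopinj _ _ hq.2 hq'.2 e2
      simp only [Prod.mk.injEq] at e3 e4
      have e5 := congrArg List.length e3.1
      have e6 := congrArg List.length e4.1
      simp at e5 e6
      omega
  have hhor : ∑ w ∈ rtWords V m, ∑ y ∈ range (L-1), |g (bot (w, y)) - g (bot (w, y+1))| ^ p ≤ E := by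
    have h := rtEdge Γ s p hp g (rtWords V m ×ˢ range (L-1))
      (fun q => bot (q.1, q.2)) (fun q => bot (q.1, q.2+1)) ?_ ?_ ?_ ?_ ?_
    · rw [← hfg] at h
      refine le_trans (le_of_eq ?_) h
      rw [Finset.sum_product]
    · rintro ⟨w, y⟩ hq
      simp only [mem_product, mem_rtWords, mem_range] at hq
      exact hbs _ _ hq.1 (by omega)
    · rintro ⟨w, y⟩ hq
      simp only [mem_product, mem_rtWords, mem_range] at hq
      exact hbs _ _ hq.1 (by omega)
    · rintro ⟨w, y⟩ hq
      simp only [mem_product, mem_rtWords, mem_range] at hq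
      have := hrowL w
      exact rtEn_adj hΓ (v ++ w) y (by omega)
    · rintro ⟨w, y⟩ hq ⟨w', y'⟩ hq' e1 e2
      simp only [mem_product, mem_rtWords, mem_range] at hq hq'
      exact hbotinj _ _ (by simp only; omega) (by simp only; omega) e1
    · rintro ⟨w, y⟩ hq ⟨w', y'⟩ hq' e1 e2
      simp only [mem_product, mem_rtWords, mem_range] at hq hq'
      have e3 := hbotinj _ _ (by simp only; omega) (by simp only; omega) e1
      have e4 := hbotinj _ _ (by simp only; omega) (by simp only; omega) e2
      simp only [Prod.mk.injEq] at e3 e4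
      omega
  obtain ⟨c, hc⟩ := rtMain H V m N L hH hV hN hL p hp hLp (fun i u => g (top (u, i)))
    (fun w y => g (bot (w, y))) pos
    (fun i hi w hw => by
      obtain ⟨h1, h2⟩ := hpos i w hi hw
      exact ⟨h1, by simp only [h2]⟩)
    (fun w hw i hi i' hi' h => by
      have h1 := (hpos i w hi hw).2
      rw [h, (hpos i' w hi' hw).2] at h1
      have := htopinj _ _ hi' hi h1
      simp only [Prod.mk.injEq, true_and] at this
      exact this.symm)
    E hE0 hvert hhor
  refine (rtCenter p hp f hf c).trans ?_
  rw [mul_assoc (2 ^ p : ℝ)]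
  refine mul_le_mul_of_nonneg_left (le_trans ?_ hc) (by positivity)
  have h5 : ∑ x : s, |f x - c| ^ p = ∑ x ∈ s, |g x - c| ^ p := by
    rw [hfg, ← Finset.sum_coe_sort s]
  rw [h5]
  have h6 : ∑ x ∈ s, |g x - c| ^ p ≤ ∑ x ∈ (rtWords V m ×ˢ range L).image bot, |g x - c| ^ p +
      ∑ x ∈ (U ×ˢ range N).image top, |g x - c| ^ p := by
    rw [← Finset.sum_union_inter]
    exact le_add_of_nonneg_right (Finset.sum_nonneg fun _ _ => by positivity)
  refine h6.trans (add_le_add ?_ ?_)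
  · refine (rtSumImage _ bot _ (fun _ => by positivity)).trans (le_of_eq ?_)
    rw [Finset.sum_product]
  · refine (rtSumImage _ top _ (fun _ => by positivity)).trans (le_of_eq ?_)
    rw [Finset.sum_product, rtSumU]

theorem rtParam (H V : ℕ) (hH : 2 ≤ H) (hV : 2 ≤ V) (a p : ℝ) (hp : 1 ≤ p)
    (ha : (V:ℝ) = (H:ℝ) ^ a) (hpQ : p < 1 + a) (m : ℕ) :
    ∃ N L : ℕ, 0 < N ∧ L = N * H ^ m ∧
      (L:ℝ) ^ p ≤ 2 ^ p * ((H:ℝ) ^ m * (V:ℝ) ^ m) ∧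
      (H:ℝ) ^ (m * (a + (1 + a) / p)) ≤ (V:ℝ) ^ m * L ∧
      (V:ℝ) ^ m * L ≤ 2 * (H:ℝ) ^ (m * (a + (1 + a) / p)) := by
  have hp0 : 0 < p := by linarith
  have hH0 : (0:ℝ) < H := by positivity
  have hH1 : (1:ℝ) ≤ H := by exact_mod_cast (by omega : 1 ≤ H)
  set X : ℝ := (H:ℝ) ^ (m * ((1 + a - p) / p)) with hX
  have hX1 : 1 ≤ X := Real.one_le_rpow hH1 (by
    have : 0 < 1 + a - p := by linarith
    positivity)
  have hle : X ≤ ⌈X⌉₊ := Nat.le_ceil X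
  have hge : (⌈X⌉₊ : ℝ) ≤ 2 * X := by
    have := Nat.ceil_lt_add_one (by linarith : 0 ≤ X); linarith
  have hHm : (H:ℝ)^m = (H:ℝ)^(m:ℝ) := (Real.rpow_natCast _ _).symm
  have hVm : (V:ℝ)^m = (H:ℝ)^(m*a) := by
    rw [← Real.rpow_natCast, ha, ← Real.rpow_mul hH0.le, mul_comm]
  have hXH : X * (H:ℝ)^m = (H:ℝ)^(m * ((1+a)/p)) := by
    rw [hX, hHm, ← Real.rpow_add hH0]; congr 1; field_simp; ring
  have hT : (H:ℝ) ^ (m * (a + (1 + a) / p)) = (V:ℝ)^m * (X * (H:ℝ)^m) := by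
    rw [hXH, hVm, ← Real.rpow_add hH0]; congr 1; ring
  refine ⟨⌈X⌉₊, ⌈X⌉₊ * H ^ m, Nat.ceil_pos.2 (by linarith), rfl, ?_, ?_, ?_⟩
  · push_cast
    calc _ ≤ (2 * X * (H:ℝ)^m) ^ p := by gcongr
      _ = 2 ^ p * (X * (H:ℝ)^m)^p := by rw [mul_assoc, Real.mul_rpow (by norm_num) (by positivity)]
      _ = _ := by
        rw [hXH, ← Real.rpow_mul hH0.le, hVm, hHm, ← Real.rpow_add hH0]
        congr 2; field_simp
  · rw [hT]; push_cast; gcongr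
  · rw [hT]; push_cast
    calc _ ≤ (V:ℝ)^m * (2 * X * (H:ℝ)^m) := by gcongr
      _ = _ := by ring

theorem rtExp (a p T : ℝ) (hp0 : 0 < p) (hT0 : 0 < T) (hT : T = a + (1 + a) / p) :
    1 - 1 / p + (1 + a - p) / (p * (1 + a - p + p * (1 + a))) = 1 + -((1 + a) / (p * T)) := by
  have h2 : p * T = 1 + a + p * a := by rw [hT]; field_simp; ring
  have h3 : 1 + a - p + p * (1 + a) = p * T := by rw [h2]; ring
  rw [h3]
  clear hT
  field_simp
  linarith

/-- Let `Γ` be a round tree graph with horizontal branching in `[2,H]`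
and vertical branching `V ≥ 2`, and set `Q = 1 + log V / log H`.  For every `p` with
`1 ≤ p < Q`, setting `ε = (Q-p)/(p(Q-p+pQ)) > 0`, there exists `c > 0` such that for
every real `r > 1` there is a finite subgraph `Y` of `Γ` with `c⁻¹ r ≤ |Y| ≤ c r` and
`|Y| · h^p(Y) ≥ c⁻¹ |Y|^(1 - 1/p + ε)`. -/
theorem roundTree_subgraph_poincare_lower (H V : ℕ) (hH : 2 ≤ H) (hV : 2 ≤ V)
    (S : Set (RTVert H V)) (Γ : SimpleGraph (RTVert H V))
    (hΓ : IsRoundTreeGraph H V S Γ)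
    (p : ℝ) (hp : 1 ≤ p) (hpQ : p < 1 + Real.log V / Real.log H) :
    0 < (1 + Real.log V / Real.log H - p) /
        (p * ((1 + Real.log V / Real.log H) - p + p * (1 + Real.log V / Real.log H))) ∧
    ∃ c > 0, ∀ r : ℝ, 1 < r →
      ∃ (s : Finset (RTVert H V)) (Y : SimpleGraph s),
        (∀ u v : s, Y.Adj u v → Γ.Adj u v) ∧
        c⁻¹ * r ≤ (s.card : ℝ) ∧ (s.card : ℝ) ≤ c * r ∧
        c⁻¹ * (s.card : ℝ) ^
            (1 - 1 / p + (1 + Real.log V / Real.log H - p) /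
              (p * ((1 + Real.log V / Real.log H) - p + p * (1 + Real.log V / Real.log H))))
          ≤ (s.card : ℝ) * poincareConst Y p := by
  have hp0 : 0 < p := by linarith
  have hH0 : (0:ℝ) < H := by positivity
  have hH1 : (1:ℝ) < H := by exact_mod_cast (by omega : 1 < H)
  have hlogH : 0 < Real.log H := Real.log_pos hH1
  set a := Real.log V / Real.log H with hadef
  have ha : (V:ℝ) = (H:ℝ) ^ a := by
    rw [Real.rpow_def_of_pos hH0, hadef, mul_div_cancel₀ _ hlogH.ne', Real.exp_log (by positivity)]
  have ha0 : 0 < a := div_pos (Real.log_pos (by exact_mod_cast (by omega : 1 < V))) hlogH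
  have hqp : 0 < 1 + a - p := by linarith
  have hden : 0 < 1 + a - p + p * (1 + a) := by positivity
  refine ⟨by positivity, ?_⟩
  set T := a + (1 + a) / p with hT
  have hT0 : 0 < T := by positivity
  have hC := rtC_nonneg V hV p hp
  have hK : 0 < rtK V p := by unfold rtK; positivity
  set M : ℝ := (2 ^ p * rtK V p) ^ (1/p) with hM
  have hM0 : 0 < M := by positivity
  set c : ℝ := 1 + 4 * (H:ℝ) ^ T + M with hc
  have hc0 : 0 < c := by positivity
  refine ⟨c, hc0, fun r hr => ?_⟩
  set t := Real.log r / (T * Real.log H) with ht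
  have ht0 : 0 ≤ t := div_nonneg (Real.log_pos hr).le (by positivity)
  have hrt : r = (H:ℝ) ^ (t * T) := by
    rw [Real.rpow_def_of_pos hH0, ht]
    have : Real.log H * (Real.log r / (T * Real.log H) * T) = Real.log r := by field_simp
    rw [this, Real.exp_log (by linarith)]
  set m := ⌊t⌋₊ + 1 with hm
  have hm1 : t ≤ m := by rw [hm]; push_cast; exact (Nat.lt_floor_add_one t).le
  have hm2 : (m:ℝ) ≤ t + 1 := by rw [hm]; push_cast; linarith [Nat.floor_le ht0]
  obtain ⟨N, L, hN, hL, hLp, hl, hu⟩ := rtParam H V hH hV a p hp ha hpQ m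
  obtain ⟨s, hs1, hs2, hs3⟩ := rtGraph hΓ hH hV m N L (by omega) hN hL p hp hLp
  have hs1' : (V:ℝ)^m * L ≤ s.card := by exact_mod_cast hs1
  have hs2' : (s.card : ℝ) ≤ 2 * ((V:ℝ)^m * L) := by exact_mod_cast hs2
  have hlow : (H:ℝ) ^ (m * T) ≤ s.card := hl.trans hs1'
  have hup : (s.card : ℝ) ≤ 4 * (H:ℝ) ^ (m * T) := by linarith
  have hr1 : r ≤ (H:ℝ) ^ (m * T) := by
    rw [hrt]; exact Real.rpow_le_rpow_of_exponent_le hH1.le (by gcongr)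
  have hr2 : (H:ℝ) ^ (m * T) ≤ (H:ℝ) ^ T * r := by
    rw [hrt, ← Real.rpow_add hH0]
    exact Real.rpow_le_rpow_of_exponent_le hH1.le (by nlinarith)
  have hB0 : (0:ℝ) < (H:ℝ) ^ (m * T) := by positivity
  have hscard : (0:ℝ) < s.card := by linarith
  have hHT : 0 < (H:ℝ) ^ T := by positivity
  refine ⟨s, Γ.comap (fun x : s => (x : RTVert H V)), fun u v h => h, ?_, ?_, ?_⟩
  · have : c⁻¹ ≤ 1 := inv_le_one_of_one_le₀ (by linarith)
    nlinarith
  · calc _ ≤ 4 * ((H:ℝ) ^ T * r) := by linarith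
      _ ≤ c * r := by rw [← mul_assoc]; gcongr; linarith
  · have e1 : 1 - 1 / p + (1 + a - p) / (p * (1 + a - p + p * (1 + a))) =
        1 + -((1 + a) / (p * T)) := by
      exact rtExp a p T hp0 hT0 hT
    rw [e1, Real.rpow_add hscard, Real.rpow_one, mul_left_comm]
    refine mul_le_mul_of_nonneg_left ?_ hscard.le
    refine le_trans ?_ hs3
    have e2 : (s.card:ℝ) ^ (-((1 + a) / (p * T))) ≤ ((H:ℝ) ^ (m * T)) ^ (-((1 + a) / (p * T))) :=
      Real.rpow_le_rpow_of_nonpos hB0 hlow (by rw [neg_nonpos]; positivity)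
    have e3 : ((H:ℝ) ^ (m * T)) ^ (-((1 + a) / (p * T))) = ((H:ℝ)^m * (V:ℝ)^m) ^ (-(1/p)) := by
      rw [← Real.rpow_mul hH0.le, ← Real.rpow_natCast, ← Real.rpow_natCast, ha,
        ← Real.rpow_mul hH0.le, ← Real.rpow_add hH0, ← Real.rpow_mul hH0.le]
      congr 1
      have hT' := hT0.ne'
      have hp' := hp0.ne'
      clear_value T a
      field_simp
    have e4 : c⁻¹ ≤ (2 ^ p * rtK V p) ^ (-(1/p)) := by
      rw [Real.rpow_neg (by positivity), ← hM]
      exact inv_anti₀ hM0 (by linarith)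
    rw [← mul_assoc, Real.mul_rpow (mul_pos (Real.rpow_pos_of_pos two_pos _) hK).le (by positivity)]
    exact mul_le_mul e4 (e2.trans e3.le) (Real.rpow_nonneg hscard.le _)
      (Real.rpow_nonneg (mul_pos (by positivity) hK).le _)
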